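/- arXiv:2602.05740 — 3 statements merged into one kernel-verified Lean document; each statement's English description precedes it below -/
import Mathlib

section
/- Let n ≥ 1 be real, let X be a complete metric space with a geodesic structure σ, let p ∈ X and r₁ > 0, and suppose: (i) for every ε > 0 there exists r₀ ∈ (0, r₁] such that for every Borel set A ⊆ ball p r₀ and every t ∈ [0,1], μH n (Φ_t^p '' A) ≥ (1−ε)·t^n·μH n A; (ii) there exist c > 0 and r₂ > 0 such that μH n (ball x s) ≥ c·s^n for all x ∈ ball p r₂ and all s ∈ (0, r₂]; (iii) limsup_{r → 0⁺} μH n (ball p r) / r^n < ∞, and μH n (ball p r₁) < ∞. Then for every δ > 0 there exists R > 0 such that for all r ∈ (0, R] and all t ∈ (0,1), the image Φ_t^p '' (ball p r) is (δ·t·r)-dense in ball p (t·r): for every y ∈ ball p (t·r) there exists x ∈ ball p r with dist (σ p x t) y ≤ δ·t·r. -/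
open Metric MeasureTheory ENNReal Filter

/-- A geodesic structure on a metric space. -/
structure GeodesicStructure (X : Type*) [MetricSpace X] where
  σ : X → X → ℝ → X
  σ_zero : ∀ x y, σ x y 0 = x
  σ_one : ∀ x y, σ x y 1 = y
  dist_σ : ∀ x y, ∀ s ∈ Set.Icc (0:ℝ) 1, ∀ t ∈ Set.Icc (0:ℝ) 1,
    dist (σ x y s) (σ x y t) = |s - t| * dist x y
  σ_comp : ∀ x y, ∀ s ∈ Set.Icc (0:ℝ) 1, ∀ t ∈ Set.Icc (0:ℝ) 1,
    σ x (σ x y t) s = σ x y (s * t)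

/-- Busemann convexity of a geodesic structure. -/
def GeodesicStructure.BusemannConvex {X : Type*} [MetricSpace X]
    (G : GeodesicStructure X) : Prop :=
  ∀ p x y : X, ∀ t ∈ Set.Icc (0:ℝ) 1, dist (G.σ p x t) (G.σ p y t) ≤ t * dist x y

/-- Geodesic completeness with respect to a geodesic structure. -/
def GeodesicStructure.GeodComplete {X : Type*} [MetricSpace X]
    (G : GeodesicStructure X) : Prop :=
  ∀ x y : X, x ≠ y → ∀ R : ℝ, dist x y ≤ R →
    ∃ z : X, dist x z = R ∧ G.σ x z (dist x y / R) = y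

/-- The measure contraction property MCP(0,N) with respect to a geodesic structure. -/
def GeodesicStructure.MCPzero {X : Type*} [MetricSpace X] [MeasurableSpace X]
    (G : GeodesicStructure X) (m : Measure X) (N : ℝ) : Prop :=
  ∀ p : X, ∀ A : Set X, MeasurableSet A → ∀ t ∈ Set.Icc (0:ℝ) 1,
    ENNReal.ofReal (t ^ N) * m A ≤ m ((fun x => G.σ p x t) '' A)

/-- An upper density bound at `p` in terms of real numbers. -/
lemma exists_measureReal_ball_le_of_limsup_lt_top {X : Type*} [PseudoMetricSpace X]
    [MeasurableSpace X] (μ : Measure X) (p : X) (n : ℝ)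
    (h : Filter.limsup (fun r : ℝ => μ (ball p r) / ENNReal.ofReal (r ^ n))
        (nhdsWithin 0 (Set.Ioi 0)) < ⊤) :
    ∃ M : ℝ, 0 ≤ M ∧ ∃ ρ : ℝ, 0 < ρ ∧ ∀ r, 0 < r → r < ρ → μ.real (ball p r) ≤ M * r ^ n := by
  obtain ⟨b, hb, hb'⟩ := exists_between h
  have hev := eventually_lt_of_limsup_lt hb
  obtain ⟨ρ, hρ, hsub⟩ := mem_nhdsGT_iff_exists_Ioo_subset.1 hev
  refine ⟨b.toReal, ENNReal.toReal_nonneg, ρ, hρ, fun r hr hrρ => ?_⟩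
  have hlt : μ (ball p r) / ENNReal.ofReal (r ^ n) < b := hsub ⟨hr, hrρ⟩
  have hpow : 0 < r ^ n := Real.rpow_pos_of_pos hr n
  have hle := (ENNReal.div_le_iff (ENNReal.ofReal_pos.2 hpow).ne' ENNReal.ofReal_ne_top).1 hlt.le
  have := ENNReal.toReal_mono (ENNReal.mul_ne_top hb'.ne ENNReal.ofReal_ne_top) hle
  rwa [ENNReal.toReal_mul, ENNReal.toReal_ofReal hpow.le] at this

/-- If `F r / r ^ n` is bounded and nonincreasing up to a factor `1 - ε`, it is almost constant
near `0`. -/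
lemma exists_scaled_le_add_of_almost_monotone {F : ℝ → ℝ} {n M ρ ε κ : ℝ}
    (hρ : 0 < ρ) (hF0 : ∀ r, 0 ≤ F r) (hε : 0 < ε) (hε1 : ε ≤ 1) (hκ : ε * (2 * M + 1) < κ)
    (hF : ∀ r, 0 < r → r ≤ ρ → F r ≤ M * r ^ n)
    (hmono : ∀ r, 0 < r → r ≤ ρ → ∀ t, 0 < t → t ≤ 1 → (1 - ε) * t ^ n * F r ≤ F (t * r)) :
    ∃ R, 0 < R ∧ R ≤ ρ ∧ ∀ r, 0 < r → r ≤ R → ∀ t, 0 < t → t < 1 →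
      F (t * r) < (1 - ε) * t ^ n * F r + κ * (t * r) ^ n := by
  set S : Set ℝ := (fun r => F r / r ^ n) '' Set.Ioc 0 ρ
  have hSM : ∀ x ∈ S, x ≤ M := by
    rintro _ ⟨r, hr, rfl⟩
    exact (div_le_iff₀ (Real.rpow_pos_of_pos hr.1 n)).2 (hF r hr.1 hr.2)
  have hSne : S.Nonempty := ⟨_, ρ, ⟨hρ, le_rfl⟩, rfl⟩
  have hSb : BddAbove S := ⟨M, hSM⟩
  set L := sSup S
  have hLM : L ≤ M := csSup_le hSne hSM
  have hL0 : 0 ≤ L :=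
    (div_nonneg (hF0 ρ) (Real.rpow_pos_of_pos hρ n).le).trans
      (le_csSup hSb ⟨ρ, ⟨hρ, le_rfl⟩, rfl⟩)
  obtain ⟨_, ⟨R, hR, rfl⟩, hRL⟩ := exists_lt_of_lt_csSup hSne (show L - ε < sSup S by grind)
  refine ⟨R, hR.1, hR.2, fun r hr hrR t ht ht1 => ?_⟩
  have hrn := Real.rpow_pos_of_pos hr n
  have htn := Real.rpow_pos_of_pos ht n
  have hRn := Real.rpow_pos_of_pos hR.1 n
  have hup : F (t * r) ≤ L * (t * r) ^ n := by
    have htr : t * r ≤ ρ := by nlinarith [hR.2]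
    exact (div_le_iff₀ (Real.rpow_pos_of_pos (mul_pos ht hr) n)).1
      (le_csSup hSb ⟨t * r, ⟨mul_pos ht hr, htr⟩, rfl⟩)
  have hlow : (1 - ε) * (L - ε) * r ^ n ≤ F r := by
    have h := hmono R hR.1 hR.2 (r / R) (div_pos hr hR.1) ((div_le_one hR.1).2 hrR)
    rw [div_mul_cancel₀ _ hR.1.ne', Real.div_rpow hr.le hR.1.le] at h
    calc (1 - ε) * (L - ε) * r ^ n ≤ (1 - ε) * (F R / R ^ n) * r ^ n := by
          have : 0 ≤ 1 - ε := by linarith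
          gcongr
      _ = (1 - ε) * (r ^ n / R ^ n) * F R := by ring
      _ ≤ F r := h
  rw [Real.mul_rpow ht.le hr.le] at hup ⊢
  have hcoef : L < (1 - ε) * ((1 - ε) * (L - ε)) + κ := by
    have h1 : ε * L ≤ ε * M := by gcongr
    have h2 : 0 ≤ ε ^ 2 * L := by positivity
    have h3 : (1 - ε) ^ 2 * ε ≤ 1 * ε := by
      gcongr
      nlinarith
    nlinarith
  have hscaled := mul_le_mul_of_nonneg_left hlow
    (mul_nonneg (sub_nonneg.2 hε1) htn.le)
  nlinarith [mul_lt_mul_of_pos_right hcoef (mul_pos htn hrn)]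

namespace GeodesicStructure

variable {X : Type*} [MetricSpace X]

lemma dist_left_σ (G : GeodesicStructure X) (x y : X) {t : ℝ} (ht : t ∈ Set.Icc (0 : ℝ) 1) :
    dist (G.σ x y t) x = t * dist x y := by
  have h := G.dist_σ x y t ht 0 (by simp)
  rwa [G.σ_zero, sub_zero, abs_of_nonneg ht.1] at h

lemma dist_σ_right (G : GeodesicStructure X) (x y : X) {t : ℝ} (ht : t ∈ Set.Icc (0 : ℝ) 1) :
    dist (G.σ x y t) y = (1 - t) * dist x y := by
  have h := G.dist_σ x y t ht 1 (by simp)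
  rwa [G.σ_one, abs_sub_comm, abs_of_nonneg (sub_nonneg.2 ht.2)] at h

lemma image_σ_ball_subset (G : GeodesicStructure X) (p : X) {t : ℝ} (ht : 0 < t) (ht1 : t ≤ 1)
    (r : ℝ) :
    (fun x => G.σ p x t) '' ball p r ⊆ ball p (t * r) := by
  rintro _ ⟨x, hx, rfl⟩
  rw [mem_ball, G.dist_left_σ p x ⟨ht.le, ht1⟩]
  exact mul_lt_mul_of_pos_left (mem_ball'.1 hx) ht

/-- Moving `y` towards the center makes room for a ball inside `ball p ρ`. -/
lemma exists_ball_subset_ball (G : GeodesicStructure X) (p : X) {y : X} {ρ η : ℝ}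
    (hη : 0 ≤ η) (hη1 : η < 1)
    (hy : y ∈ ball p ρ) :
    ∃ z, dist z y ≤ η * ρ ∧ ball z (η * ρ) ⊆ ball p ρ := by
  have hd := mem_ball'.1 hy
  have hI : 1 - η ∈ Set.Icc (0 : ℝ) 1 := ⟨by linarith, by linarith⟩
  refine ⟨G.σ p y (1 - η), ?_, ball_subset_ball' ?_⟩
  · rw [G.dist_σ_right p y hI, _root_.sub_sub_cancel]
    gcongr
  · rw [G.dist_left_σ p y hI]
    nlinarith

end GeodesicStructure

theorem noncollapsed_mcp_almost_extendability
    (n : ℝ) (hn : 1 ≤ n)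
    (X : Type*) [MetricSpace X] [CompleteSpace X] [MeasurableSpace X] [BorelSpace X]
    (G : GeodesicStructure X) (p : X) (r₁ : ℝ) (hr₁ : 0 < r₁)
    (hAlmostMCP : ∀ ε : ℝ, 0 < ε → ∃ r₀ : ℝ, 0 < r₀ ∧ r₀ ≤ r₁ ∧
      ∀ A : Set X, A ⊆ ball p r₀ → MeasurableSet A → ∀ t ∈ Set.Icc (0:ℝ) 1,
        ENNReal.ofReal ((1 - ε) * t ^ n) * μH[n] A ≤ μH[n] ((fun x => G.σ p x t) '' A))
    (hLower : ∃ c : ℝ, 0 < c ∧ ∃ r₂ : ℝ, 0 < r₂ ∧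
      ∀ x ∈ ball p r₂, ∀ s : ℝ, 0 < s → s ≤ r₂ →
        ENNReal.ofReal (c * s ^ n) ≤ μH[n] (ball x s))
    (hUpper : Filter.limsup (fun r : ℝ => μH[n] (ball p r) / ENNReal.ofReal (r ^ n))
        (nhdsWithin 0 (Set.Ioi 0)) < ⊤)
    (hfin : μH[n] (ball p r₁) < ⊤) :
    ∀ δ : ℝ, 0 < δ → ∃ R : ℝ, 0 < R ∧
      ∀ r : ℝ, 0 < r → r ≤ R → ∀ t : ℝ, 0 < t → t < 1 →
        ∀ y ∈ ball p (t * r), ∃ x ∈ ball p r, dist (G.σ p x t) y ≤ δ * t * r := by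
  intro δ hδ
  obtain ⟨c, hc, r₂, hr₂, hlow⟩ := hLower
  obtain ⟨M, hM, ρ₀, hρ₀, hup⟩ := exists_measureReal_ball_le_of_limsup_lt_top μH[n] p n hUpper
  obtain ⟨η, hη, hη1, hηδ⟩ : ∃ η : ℝ, 0 < η ∧ η < 1 ∧ 2 * η ≤ δ :=
    ⟨min δ 1 / 2, by positivity, by linarith [min_le_right δ 1], by linarith [min_le_left δ 1]⟩
  have hκ : 0 < c * η ^ n := mul_pos hc (Real.rpow_pos_of_pos hη n)
  obtain ⟨ε, hε, hε1, hεκ⟩ : ∃ ε : ℝ, 0 < ε ∧ ε ≤ 1 ∧ ε * (2 * M + 1) < c * η ^ n := by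
    refine ⟨min 1 (c * η ^ n / (2 * M + 2)), by positivity, min_le_left _ _, ?_⟩
    calc _ ≤ c * η ^ n / (2 * M + 2) * (2 * M + 1) := by gcongr; exact min_le_right _ _
      _ < c * η ^ n / (2 * M + 2) * (2 * M + 2) := by gcongr; norm_num
      _ = c * η ^ n := by field_simp
  obtain ⟨r₀, hr₀, hr₀₁, hmcp⟩ := hAlmostMCP ε hε
  have hfinite : ∀ r ≤ r₀, μH[n] (ball p r) ≠ ⊤ := fun r hr =>
    ((measure_mono (ball_subset_ball (hr.trans hr₀₁))).trans_lt hfin).ne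
  have himage : ∀ r ≤ r₀, ∀ t, 0 < t → t ≤ 1 → (1 - ε) * t ^ n * μH[n].real (ball p r) ≤
      μH[n].real ((fun x => G.σ p x t) '' ball p r) := by
    intro r hr t ht ht1
    have hsub := G.image_σ_ball_subset p ht ht1 r
    have htr : μH[n] (ball p (t * r)) ≠ ⊤ := by
      rcases le_or_gt r 0 with h | h
      · exact hfinite _ ((mul_nonpos_of_nonneg_of_nonpos ht.le h).trans hr₀.le)
      · exact hfinite _ ((mul_le_of_le_one_left h.le ht1).trans hr)
    have h := ENNReal.toReal_mono (measure_ne_top_of_subset hsub htr)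
      (hmcp _ (ball_subset_ball hr) measurableSet_ball t ⟨ht.le, ht1⟩)
    rwa [ENNReal.toReal_mul, ENNReal.toReal_ofReal
      (mul_nonneg (sub_nonneg.2 hε1) (Real.rpow_nonneg ht.le n))] at h
  have hρ : 0 < min r₀ (ρ₀ / 2) := by positivity
  obtain ⟨R, hR, hRρ, hgap⟩ := exists_scaled_le_add_of_almost_monotone
    (F := fun r => μH[n].real (ball p r)) hρ (fun _ => measureReal_nonneg) hε hε1 hεκ
    (fun r hr hrρ => hup r hr (by linarith [hrρ.trans (min_le_right _ _)]))
    (fun r hr hrρ t ht ht1 => by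
      have hr' := hrρ.trans (min_le_left _ _)
      exact (himage r hr' t ht ht1).trans (measureReal_mono (G.image_σ_ball_subset p ht ht1 r)
        (hfinite _ ((mul_le_of_le_one_left hr.le ht1).trans hr'))))
  refine ⟨min R r₂, by positivity, fun r hr hrR t ht ht1 y hy => ?_⟩
  have hrR' := hrR.trans (min_le_left _ _)
  have hrr₂ := hrR.trans (min_le_right _ _)
  have hrr₀ := hrR'.trans (hRρ.trans (min_le_left _ _))
  have htr : 0 < t * r := mul_pos ht hr
  have htrr : t * r ≤ r := mul_le_of_le_one_left hr.le ht1.le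
  obtain ⟨z, hzy, hzsub⟩ := G.exists_ball_subset_ball p hη.le hη1 hy
  have hs : 0 < η * (t * r) := mul_pos hη htr
  have hBfin := hfinite (t * r) (htrr.trans hrr₀)
  have hsub := G.image_σ_ball_subset p ht ht1.le r
  have hmeet : ¬ Disjoint ((fun x => G.σ p x t) '' ball p r) (ball z (η * (t * r))) := by
    intro hdisj
    have hz : z ∈ ball p r₂ :=
      ball_subset_ball (htrr.trans hrr₂) (hzsub (mem_ball_self hs))
    have hzball := ENNReal.toReal_mono (measure_ne_top_of_subset hzsub hBfin)
      (hlow z hz _ hs ((mul_le_of_le_one_left htr.le hη1.le).trans (htrr.trans hrr₂)))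
    rw [ENNReal.toReal_ofReal (mul_nonneg hc.le (Real.rpow_nonneg hs.le n)),
      Real.mul_rpow hη.le htr.le, ← mul_assoc] at hzball
    have hunion := measureReal_union hdisj measurableSet_ball
      (measure_ne_top_of_subset hsub hBfin) (measure_ne_top_of_subset hzsub hBfin)
    have hle := measureReal_mono (Set.union_subset hsub hzsub) hBfin
    rw [hunion] at hle
    have := hgap r hr hrR' t ht ht1
    have := himage r hrr₀ t ht ht1.le
    simp only [Measure.real] at *
    linarith
  obtain ⟨_, ⟨x, hx, rfl⟩, hxz⟩ := Set.not_disjoint_iff.1 hmeet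
  refine ⟨x, hx, ?_⟩
  calc dist (G.σ p x t) y ≤ dist (G.σ p x t) z + dist z y := dist_triangle _ _ _
    _ ≤ η * (t * r) + η * (t * r) := add_le_add (mem_ball.1 hxz).le hzy
    _ = 2 * η * (t * r) := by ring
    _ ≤ δ * (t * r) := by gcongr
    _ = δ * t * r := by ring
end

section
/- Let X be a complete metric space with a geodesic structure σ that is Busemann convex, let n ≥ 1 be real and δ ∈ (0,1), let p ∈ X and R > 0, and suppose: geodesics from ball p R extend to length 9R with respect to σ; the n-dimensional Hausdorff measure μH n is locally finite, positive on every nonempty open set, and 0 < μH n (ball p R) < ∞; and the δ-almost MCP(0,n) holds: μH n (Φ_t^{p'} '' A) ≥ (1−δ)·t^n·μH n A for every p' ∈ X, every Borel set A ⊆ X and every t ∈ [0,1]. Then there exists C > 0 such that for every x ∈ ball p R and every r ∈ (0,R): (1−δ)²·C·r^n ≤ μH n (ball x r) ≤ (1−δ)⁻¹·C·r^n. -/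
open Metric MeasureTheory ENNReal Filter

/-- Geodesics from `ball q R` extend to length `9R` with respect to `G`. -/
def ExtendsTo {X : Type*} [MetricSpace X] (G : GeodesicStructure X) (q : X) (R : ℝ) : Prop :=
  ∀ x ∈ Metric.ball q R, ∀ y : X, 0 < dist x y → dist x y ≤ 9 * R →
    ∀ s : ℝ, dist x y ≤ s → s ≤ 9 * R →
      ∃ z : X, dist x z = s ∧ G.σ x z (dist x y / s) = y

namespace GeodesicStructure

variable {X : Type*} [MetricSpace X] (G : GeodesicStructure X)

lemma dist_start {t : ℝ} (x y : X) (ht : t ∈ Set.Icc (0:ℝ) 1) :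
    dist (G.σ x y t) x = t * dist x y := by
  have h := G.dist_σ x y t ht 0 ⟨le_rfl, zero_le_one⟩
  rwa [G.σ_zero, sub_zero, abs_of_nonneg ht.1] at h

lemma σ_self {t : ℝ} (x : X) (ht : t ∈ Set.Icc (0:ℝ) 1) : G.σ x x t = x := by
  simpa using G.dist_start x x ht

variable {G}

lemma BusemannConvex.image_ball_subset (hB : G.BusemannConvex) (x y : X) (r : ℝ) {t : ℝ}
    (ht0 : 0 < t) (ht1 : t ≤ 1) :
    (fun z => G.σ x z t) '' ball y r ⊆ ball (G.σ x y t) (t * r) := by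
  rintro _ ⟨z, hz, rfl⟩
  exact (hB x z y t ⟨ht0.le, ht1⟩).trans_lt (mul_lt_mul_of_pos_left hz ht0)

lemma BusemannConvex.hausdorffMeasure_image_le [MeasurableSpace X] [BorelSpace X]
    (hB : G.BusemannConvex) {n : ℝ} (hn : 0 ≤ n) (x : X) (A : Set X) {t : ℝ}
    (ht : t ∈ Set.Icc (0:ℝ) 1) :
    μH[n] ((fun z => G.σ x z t) '' A) ≤ ENNReal.ofReal (t ^ n) * μH[n] A := by
  have hL : LipschitzWith t.toNNReal (fun z => G.σ x z t) :=
    LipschitzWith.of_dist_le_mul fun y z => by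
      rw [Real.coe_toNNReal _ ht.1]
      exact hB x y z t ht
  refine (hL.lipschitzOnWith.hausdorffMeasure_image_le hn).trans_eq ?_
  rw [← ENNReal.ofReal_rpow_of_nonneg ht.1 hn]
  rfl

end GeodesicStructure

lemma ExtendsTo.ball_subset_image {X : Type*} [MetricSpace X] {G : GeodesicStructure X}
    {p : X} {R : ℝ} (hext : ExtendsTo G p R) {x : X} (hx : x ∈ ball p R) {r t : ℝ}
    (hr : 0 < r) (hrR : r ≤ 9 * R) (ht0 : 0 < t) (ht1 : t ≤ 1) :
    ball x (t * r) ⊆ (fun z => G.σ x z t) '' ball x r := by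
  intro y hy
  rw [mem_ball'] at hy
  rcases eq_or_ne x y with rfl | hxy
  · exact ⟨x, mem_ball_self hr, G.σ_self x ⟨ht0.le, ht1⟩⟩
  have hd : 0 < dist x y := dist_pos.2 hxy
  have hlt : dist x y / t < r := by rwa [div_lt_iff₀' ht0]
  have hle : dist x y ≤ dist x y / t := le_div_self hd.le ht0 ht1
  obtain ⟨z, hz, hσ⟩ := hext x hx y hd (by linarith) _ hle (by linarith)
  rw [div_div_cancel₀ hd.ne'] at hσ
  exact ⟨z, by rwa [mem_ball', hz], hσ⟩

section AlmostMCP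

variable {X : Type*} [MetricSpace X] [MeasurableSpace X] [BorelSpace X]
  {G : GeodesicStructure X} {n δ : ℝ} {p : X} {R : ℝ}

/-- The almost measure contraction property bounds the measure of contracted balls from below. -/
lemma ofReal_mul_hausdorffMeasure_ball_le (hB : G.BusemannConvex)
    (hMCP : ∀ p' : X, ∀ A : Set X, MeasurableSet A → ∀ t ∈ Set.Icc (0:ℝ) 1,
      ENNReal.ofReal ((1 - δ) * t ^ n) * μH[n] A ≤ μH[n] ((fun x => G.σ p' x t) '' A))
    (x y : X) (r : ℝ) {t : ℝ} (ht0 : 0 < t) (ht1 : t ≤ 1) :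
    ENNReal.ofReal ((1 - δ) * t ^ n) * μH[n] (ball y r) ≤
      μH[n] (ball (G.σ x y t) (t * r)) :=
  (hMCP x _ measurableSet_ball t ⟨ht0.le, ht1⟩).trans
    (measure_mono (hB.image_ball_subset x y r ht0 ht1))

lemma hausdorffMeasure_ball_lt_top (hB : G.BusemannConvex) (hδ1 : δ < 1)
    (hball : μH[n] (ball p R) < ⊤)
    (hMCP : ∀ p' : X, ∀ A : Set X, MeasurableSet A → ∀ t ∈ Set.Icc (0:ℝ) 1,
      ENNReal.ofReal ((1 - δ) * t ^ n) * μH[n] A ≤ μH[n] ((fun x => G.σ p' x t) '' A))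
    {x : X} (hx : x ∈ ball p R) (r : ℝ) : μH[n] (ball x r) < ⊤ := by
  obtain ⟨ε, hε, hsub⟩ := Metric.isOpen_iff.1 isOpen_ball x hx
  rcases le_or_gt r ε with hr | hr
  · exact (measure_mono ((ball_subset_ball hr).trans hsub)).trans_lt hball
  have hr0 : 0 < r := hε.trans hr
  have ht0 : 0 < ε / r := div_pos hε hr0
  have ht1 : ε / r ≤ 1 := (div_le_one hr0).2 hr.le
  have h := ofReal_mul_hausdorffMeasure_ball_le hB hMCP x x r ht0 ht1
  rw [G.σ_self x ⟨ht0.le, ht1⟩, div_mul_cancel₀ _ hr0.ne'] at h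
  refine lt_top_of_mul_ne_top_right ((h.trans (measure_mono hsub)).trans_lt hball).ne ?_
  exact (ENNReal.ofReal_pos.2 (mul_pos (by linarith) (Real.rpow_pos_of_pos ht0 n))).ne'

/-- Up to the factor `(1 - δ) ^ 2`, the density of a ball centered in `ball p R` is at least that
of any other ball, as long as both radii are less than `R`. -/
lemma hausdorffMeasure_ball_density_le (hB : G.BusemannConvex) (hn : 0 ≤ n) (hδ1 : δ < 1)
    (hR : 0 < R) (hext : ExtendsTo G p R) (hball : μH[n] (ball p R) < ⊤)
    (hMCP : ∀ p' : X, ∀ A : Set X, MeasurableSet A → ∀ t ∈ Set.Icc (0:ℝ) 1,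
      ENNReal.ofReal ((1 - δ) * t ^ n) * μH[n] A ≤ μH[n] ((fun x => G.σ p' x t) '' A))
    {x y : X} (hx : x ∈ ball p R) {r s : ℝ} (hr0 : 0 < r) (hrR : r < R)
    (hs0 : 0 < s) (hsR : s < R) :
    (1 - δ) ^ 2 * ((μH[n]).real (ball y s) / s ^ n) ≤ (μH[n]).real (ball x r) / r ^ n := by
  have hfin : ∀ {z : X}, z ∈ ball p R → ∀ a, μH[n] (ball z a) ≠ ⊤ := fun hz a =>
    (hausdorffMeasure_ball_lt_top hB hδ1 hball hMCP hz a).ne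
  have hδ : 0 < 1 - δ := by linarith
  have hlow : ∀ {w z : X} {a t : ℝ}, 0 < t → t ≤ 1 → G.σ w z t ∈ ball p R →
      (1 - δ) * t ^ n * (μH[n]).real (ball z a) ≤
        (μH[n]).real (ball (G.σ w z t) (t * a)) := by
    intro w z a t ht0 ht1 hz
    have h := ENNReal.toReal_mono (hfin hz _)
      (ofReal_mul_hausdorffMeasure_ball_le hB hMCP w z a ht0 ht1)
    rwa [ENNReal.toReal_mul, ENNReal.toReal_ofReal
      (mul_nonneg hδ.le (Real.rpow_nonneg ht0.le n))] at h
  have hupp : ∀ {z : X} {t : ℝ}, z ∈ ball p R → 0 < t → t ≤ 1 →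
      (μH[n]).real (ball z (t * R)) ≤ t ^ n * (μH[n]).real (ball z R) := by
    intro z t hz ht0 ht1
    have h := (measure_mono (hext.ball_subset_image hz hR (by linarith) ht0 ht1)).trans
      (hB.hausdorffMeasure_image_le hn z (ball z R) ⟨ht0.le, ht1⟩)
    have h' := ENNReal.toReal_mono (ENNReal.mul_ne_top ENNReal.ofReal_ne_top (hfin hz R)) h
    rwa [ENNReal.toReal_mul, ENNReal.toReal_ofReal (Real.rpow_nonneg ht0.le n)] at h'
  have hdist : Tendsto (fun t : ℝ => t * dist x y) (nhdsWithin 0 (Set.Ioi 0)) (nhds 0) := by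
    have : ContinuousAt (fun t : ℝ => t * dist x y) 0 := by fun_prop
    simpa [ContinuousAt] using this.tendsto.mono_left nhdsWithin_le_nhds
  obtain ⟨ε, hε, hsub⟩ := Metric.isOpen_iff.1 isOpen_ball x hx
  have hineq : ∀ᶠ t : ℝ in nhdsWithin 0 (Set.Ioi 0),
      (1 - δ) ^ 2 * ((μH[n]).real (ball y s) / s ^ n) ≤
        ((R + t * dist x y) / R) ^ n * ((μH[n]).real (ball x r) / r ^ n) := by
    filter_upwards [Ioc_mem_nhdsGT zero_lt_one, hdist.eventually_lt_const hε] with t ht htε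
    obtain ⟨ht0, ht1⟩ := ht
    have htI : t ∈ Set.Icc (0:ℝ) 1 := ⟨ht0.le, ht1⟩
    have hd := G.dist_start x y htI
    have hz : G.σ x y t ∈ ball p R := hsub (by rwa [mem_ball, hd])
    set z := G.σ x y t
    set D := R + t * dist x y with hD
    have hRD : R ≤ D := le_add_of_nonneg_right (mul_nonneg ht0.le dist_nonneg)
    have hD0 : 0 < D := hR.trans_le hRD
    have h1 : (1 - δ) * t ^ n * (μH[n]).real (ball y s) ≤ (μH[n]).real (ball z (t * s)) :=
      hlow ht0 ht1 hz
    have hts0 : 0 < t * s / R := by positivity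
    have hts1 : t * s / R ≤ 1 := by
      rw [div_le_one hR]
      nlinarith
    have h2 := hupp hz hts0 hts1
    rw [div_mul_cancel₀ _ hR.ne'] at h2
    have h3 : (μH[n]).real (ball z R) ≤ (μH[n]).real (ball x D) :=
      measureReal_mono (ball_subset_ball' (by rw [hd])) (hfin hx D)
    have hrD0 : 0 < r / D := by positivity
    have hrD1 : r / D ≤ 1 := (div_le_one hD0).2 (hrR.le.trans hRD)
    have h4 := hlow (w := x) (z := x) (a := D) hrD0 hrD1
      (by rwa [G.σ_self x ⟨hrD0.le, hrD1⟩])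
    rw [G.σ_self x ⟨hrD0.le, hrD1⟩, div_mul_cancel₀ _ hD0.ne'] at h4
    rw [Real.div_rpow (by positivity) hR.le, Real.mul_rpow ht0.le hs0.le] at h2
    rw [Real.div_rpow hr0.le hD0.le] at h4
    rw [Real.div_rpow hD0.le hR.le]
    have htn : 0 < t ^ n := Real.rpow_pos_of_pos ht0 n
    have hsn : 0 < s ^ n := Real.rpow_pos_of_pos hs0 n
    have hrn : 0 < r ^ n := Real.rpow_pos_of_pos hr0 n
    have hRn : 0 < R ^ n := Real.rpow_pos_of_pos hR n
    have hDn : 0 < D ^ n := Real.rpow_pos_of_pos hD0 n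
    have h5 : (1 - δ) * ((μH[n]).real (ball y s) / s ^ n) ≤
        (μH[n]).real (ball x D) / R ^ n := by
      have h := (h1.trans h2).trans (mul_le_mul_of_nonneg_left h3 (by positivity))
      rw [← mul_le_mul_iff_of_pos_left (mul_pos htn hsn)]
      calc _ = (1 - δ) * t ^ n * (μH[n]).real (ball y s) := by field_simp
        _ ≤ _ := h
        _ = _ := by ring
    calc (1 - δ) ^ 2 * ((μH[n]).real (ball y s) / s ^ n)
        = (1 - δ) * ((1 - δ) * ((μH[n]).real (ball y s) / s ^ n)) := by ring
      _ ≤ (1 - δ) * ((μH[n]).real (ball x D) / R ^ n) := by gcongr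
      _ = D ^ n / R ^ n / r ^ n * ((1 - δ) * (r ^ n / D ^ n) * (μH[n]).real (ball x D)) := by
        field_simp
      _ ≤ D ^ n / R ^ n / r ^ n * (μH[n]).real (ball x r) := by gcongr
      _ = _ := by ring
  have hlim : Tendsto
      (fun t : ℝ => ((R + t * dist x y) / R) ^ n * ((μH[n]).real (ball x r) / r ^ n))
      (nhdsWithin 0 (Set.Ioi 0)) (nhds ((μH[n]).real (ball x r) / r ^ n)) := by
    have h : Tendsto (fun t : ℝ => ((R + t * dist x y) / R) ^ n)
        (nhdsWithin 0 (Set.Ioi 0)) (nhds (((R + 0) / R) ^ n)) :=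
      ((hdist.const_add R).div_const R).rpow_const (Or.inr hn)
    rw [add_zero, div_self hR.ne', Real.one_rpow] at h
    simpa using h.mul_const ((μH[n]).real (ball x r) / r ^ n)
  exact ge_of_tendsto hlim hineq

end AlmostMCP

theorem almost_mcp_almost_ball_homogeneity
    (X : Type*) [MetricSpace X] [CompleteSpace X] [MeasurableSpace X] [BorelSpace X]
    (G : GeodesicStructure X) (hB : G.BusemannConvex)
    (n : ℝ) (hn : 1 ≤ n) (δ : ℝ) (hδ0 : 0 < δ) (hδ1 : δ < 1)
    (p : X) (R : ℝ) (hR : 0 < R) (hext : ExtendsTo G p R)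
    (hlf : IsLocallyFiniteMeasure (μH[n] : Measure X))
    (hpos : (μH[n] : Measure X).IsOpenPosMeasure)
    (hball0 : 0 < μH[n] (Metric.ball p R)) (hball1 : μH[n] (Metric.ball p R) < ⊤)
    (hMCP : ∀ p' : X, ∀ A : Set X, MeasurableSet A → ∀ t ∈ Set.Icc (0:ℝ) 1,
      ENNReal.ofReal ((1 - δ) * t ^ n) * μH[n] A ≤ μH[n] ((fun x => G.σ p' x t) '' A)) :
    ∃ C : ℝ, 0 < C ∧ ∀ x ∈ Metric.ball p R, ∀ r : ℝ, 0 < r → r < R →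
      ENNReal.ofReal ((1 - δ) ^ 2 * C * r ^ n) ≤ μH[n] (Metric.ball x r) ∧
        μH[n] (Metric.ball x r) ≤ ENNReal.ofReal ((1 - δ)⁻¹ * C * r ^ n) := by
  have hδ : 0 < 1 - δ := by linarith
  have hn0 : 0 ≤ n := by linarith
  have hfin : ∀ {x : X}, x ∈ ball p R → ∀ r, μH[n] (ball x r) ≠ ⊤ := fun hx r =>
    (hausdorffMeasure_ball_lt_top hB hδ1 hball1 hMCP hx r).ne
  set S : Set ℝ := {a | ∃ y ∈ ball p R, ∃ s : ℝ, 0 < s ∧ s < R ∧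
    a = (μH[n]).real (ball y s) / s ^ n} with hS
  have hle : ∀ a ∈ S, ∀ x ∈ ball p R, ∀ r : ℝ, 0 < r → r < R →
      (1 - δ) ^ 2 * a ≤ (μH[n]).real (ball x r) / r ^ n := by
    rintro _ ⟨y, -, s, hs0, hsR, rfl⟩ x hx r hr0 hrR
    exact hausdorffMeasure_ball_density_le hB hn0 hδ1 hR hext hball1 hMCP hx hr0 hrR hs0 hsR
  have hp : p ∈ ball p R := mem_ball_self hR
  have hbdd : BddAbove S :=
    ⟨_, fun a ha => (le_div_iff₀' (by positivity)).2 (hle a ha p hp (R / 2) (by linarith)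
      (by linarith))⟩
  have hmem : (μH[n]).real (ball p (R / 2)) / (R / 2) ^ n ∈ S :=
    ⟨p, hp, R / 2, by linarith, by linarith, rfl⟩
  have hpos' : 0 < sSup S := by
    refine lt_of_lt_of_le (div_pos ?_ (Real.rpow_pos_of_pos (by linarith) n))
      (le_csSup hbdd hmem)
    exact ENNReal.toReal_pos (measure_ball_pos _ p (by linarith)).ne' (hfin hp _)
  refine ⟨(1 - δ) * sSup S, mul_pos hδ hpos', fun x hx r hr0 hrR => ?_⟩
  have hrn : 0 < r ^ n := Real.rpow_pos_of_pos hr0 n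
  rw [← ofReal_measureReal (hfin hx r)]
  refine ⟨ENNReal.ofReal_le_ofReal ?_, ENNReal.ofReal_le_ofReal ?_⟩
  · rw [← le_div_iff₀ hrn]
    have h : (1 - δ) ^ 2 * sSup S ≤ (μH[n]).real (ball x r) / r ^ n :=
      (le_div_iff₀' (by positivity)).1 <| csSup_le ⟨_, hmem⟩ fun a ha =>
        (le_div_iff₀' (by positivity)).2 (hle a ha x hx r hr0 hrR)
    refine le_trans ?_ h
    exact mul_le_mul_of_nonneg_left (mul_le_of_le_one_left hpos'.le (by linarith))
      (by positivity)
  · rw [inv_mul_cancel_left₀ hδ.ne', ← div_le_iff₀ hrn]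
    exact le_csSup hbdd ⟨x, hx, r, hr0, hrR, rfl⟩
end

section
/- For every real N with 2 < N < 3 there exists r₀ > 0 such that for every r ∈ (0, r₀] and every t ∈ [0,1], sinh (t·r) ≥ t^(N−1) · sinh r. -/
/-- If `cosh r ≤ a`, then `x ↦ sinh x / x ^ a` is antitone on `(0, r]`. -/
theorem antitoneOn_sinh_mul_rpow_neg {a r : ℝ} (h : Real.cosh r ≤ a) :
    AntitoneOn (fun x : ℝ => Real.sinh x * x ^ (-a)) (Set.Ioc 0 r) := by
  have hd : ∀ x : ℝ, 0 < x → HasDerivAt (fun x : ℝ => Real.sinh x * x ^ (-a))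
      (Real.cosh x * x ^ (-a) + Real.sinh x * (-a * x ^ (-a - 1))) x := fun x hx =>
    (Real.hasDerivAt_sinh x).mul (Real.hasDerivAt_rpow_const (Or.inl hx.ne'))
  refine antitoneOn_of_deriv_nonpos (convex_Ioc 0 r)
    (fun x hx => (hd x hx.1).continuousAt.continuousWithinAt)
    (fun x hx => (hd x (interior_subset hx).1).differentiableAt.differentiableWithinAt) ?_
  intro x hx
  obtain ⟨hx0, hxr⟩ := interior_subset hx
  have hcosh : Real.cosh x ≤ a := (Real.cosh_le_cosh.2 (by
    rw [abs_of_pos hx0, abs_of_pos (hx0.trans_le hxr)]; exact hxr)).trans h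
  have hsinh : x ≤ Real.sinh x := Real.self_le_sinh_iff.2 hx0.le
  have ha : 0 ≤ a := (Real.cosh_pos x).le.trans hcosh
  have hpow : x ^ (-a) = x * x ^ (-a - 1) := by
    rw [Real.rpow_sub_one hx0.ne']
    field_simp
  have key : x * Real.cosh x ≤ a * Real.sinh x := by
    rw [mul_comm x]
    exact mul_le_mul hcosh hsinh hx0.le ha
  rw [(hd x hx0).deriv, hpow]
  nlinarith [mul_le_mul_of_nonneg_right key (Real.rpow_nonneg hx0.le (-a - 1))]

theorem sinh_comparison (N : ℝ) (h2 : 2 < N) (h3 : N < 3) :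
    ∃ r₀ : ℝ, 0 < r₀ ∧ ∀ r : ℝ, 0 < r → r ≤ r₀ → ∀ t ∈ Set.Icc (0:ℝ) 1,
      t ^ (N - 1) * Real.sinh r ≤ Real.sinh (t * r) := by
  have hN : Real.cosh 0 < N - 1 := by rw [Real.cosh_zero]; linarith
  obtain ⟨r₀, hr₀, hpos⟩ := (((Real.continuous_cosh.tendsto 0).eventually_lt_const hN
    |>.filter_mono nhdsWithin_le_nhds).and
      (self_mem_nhdsWithin : Set.Ioi (0 : ℝ) ∈ nhdsWithin 0 (Set.Ioi 0))).exists
  refine ⟨r₀, hpos, fun r hr hrr t ⟨ht0, ht1⟩ => ?_⟩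
  rcases ht0.eq_or_lt with rfl | ht
  · rw [Real.zero_rpow (by linarith)]
    simp
  have hle : t * r ≤ r := mul_le_of_le_one_left hr.le ht1
  have hanti := antitoneOn_sinh_mul_rpow_neg hr₀.le
    ⟨mul_pos ht hr, hle.trans hrr⟩ ⟨hr, hrr⟩ hle
  simp only [Real.mul_rpow ht.le hr.le, Real.rpow_neg ht.le, Real.rpow_neg hr.le,
    ← mul_assoc] at hanti
  have hr' : 0 < (r ^ (N - 1))⁻¹ := inv_pos.2 (Real.rpow_pos_of_pos hr _)
  have hdiv := le_of_mul_le_mul_right hanti hr'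
  rw [← div_eq_mul_inv, le_div_iff₀ (Real.rpow_pos_of_pos ht _)] at hdiv
  rwa [mul_comm]
end
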